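/- For every commutative ring R, every family w : ℤ → R, every integer ℓ ≥ 0 and every n ∈ ℤ, the identity A_{ℓ,0}(n) = w_{n+1} A_{ℓ-1,1}(n) + w_n A_{ℓ-1,1}(n−1) holds. -/

import Mathlib

/-- Coefficients of the powers `P^ℓ = Σ_k (aAux w ℓ k n) Λ^k` of the difference
operator `P = Λ + w_n Λ⁻¹` (natural-number power index `ℓ ≥ 0`). -/
def aAux {R : Type*} [CommRing R] (w : ℤ → R) : ℕ → ℤ → ℤ → R
  | 0, k, _ => if k = 0 then 1 else 0
  | l + 1, k, n => aAux w l (k - 1) n + w (n + k + 1) * aAux w l (k + 1) n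

/-- `aCoef w ℓ k n` is `A_{ℓ,k}(n)`, the coefficient of `Λ^k` in `P^{ℓ+1}`,
for an integer `ℓ` (meaningful for `ℓ ≥ -1`). -/
def aCoef {R : Type*} [CommRing R] (w : ℤ → R) (l k n : ℤ) : R := aAux w (l + 1).toNat k n

/-- The recursion for the coefficients coming from the factorization `P^(l+1) = P * P^l`. -/
theorem aAux_succ_left {R : Type*} [CommRing R] (w : ℤ → R) (l : ℕ) (k n : ℤ) :
    aAux w (l + 1) k n = aAux w l (k - 1) (n + 1) + w n * aAux w l (k + 1) (n - 1) := by
  induction l generalizing k n with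
  | zero =>
    simp only [aAux]
    by_cases h : k + 1 = 0
    · rw [show n + k + 1 = n by omega]
    · simp [h]
  | succ l ih =>
    rw [aAux, ih, ih, aAux, aAux,
      show n + 1 + (k - 1) + 1 = n + k + 1 by ring, show n - 1 + (k + 1) + 1 = n + k + 1 by ring,
      show k - 1 + 1 = k by ring, show k + 1 - 1 = k by ring]
    ring

/-- The symmetry relating the coefficients of `Λ^(-k)` and `Λ^k` in `P^l`. -/
theorem aAux_neg {R : Type*} [CommRing R] (w : ℤ → R) (l k : ℕ) (n : ℤ) :
    aAux w l (-k) n = (∏ i ∈ Finset.range k, w (n - i)) * aAux w l k (n - k) := by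
  induction l generalizing k n with
  | zero =>
    cases k with
    | zero => simp
    | succ k =>
      rw [aAux, aAux, if_neg (by omega), if_neg (by omega), mul_zero]
  | succ l ih =>
    cases k with
    | zero => simp
    | succ k =>
      have h₁ := ih (k + 2) n
      have h₂ := ih k n
      rw [aAux_succ_left w l ((k + 1 : ℕ) : ℤ), aAux]
      simp only [Finset.prod_range_succ] at h₁ ⊢
      push_cast at h₁ h₂ ⊢
      rw [show -((k : ℤ) + 1) - 1 = -(k + 2) by ring, show -((k : ℤ) + 1) + 1 = -k by ring,
        show n + -((k : ℤ) + 1) + 1 = n - k by ring, show (k : ℤ) + 1 - 1 = k by ring,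
        show n - ((k : ℤ) + 1) + 1 = n - k by ring, show (k : ℤ) + 1 + 1 = k + 2 by ring,
        show n - ((k : ℤ) + 1) - 1 = n - (k + 2) by ring, h₁, h₂]
      ring

theorem aCoef_zero_eq (R : Type*) [CommRing R] (w : ℤ → R) (l : ℤ) (hl : 0 ≤ l) (n : ℤ) :
    aCoef w l 0 n = w (n + 1) * aCoef w (l - 1) 1 n + w n * aCoef w (l - 1) 1 (n - 1) := by
  lift l to ℕ using hl
  have h := aAux_neg w l 1 n
  simp only [aCoef, show ((l : ℤ) + 1).toNat = l + 1 by omega,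
    show ((l : ℤ) - 1 + 1).toNat = l by omega, aAux]
  simp only [Nat.cast_one, Finset.prod_range_one, Nat.cast_zero, sub_zero] at h
  simp [h, add_comm]
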